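/- Suppose the ADMM iterates (x^k, λ^k)_{k∈ℕ} satisfy, for every k, the first-order optimality condition ∇f(x^{k+1}) + Aᵀλ^k + Aᵀρ^k A x^k + Q̄(x^{k+1} − x^k) = 0 and the multiplier update λ^{k+1} = λ^k + ρ^{k+1} A x^{k+1}; suppose Condition A holds (ρ^0 ⪯ ρ^k ⪯ ρ^{k+1} ⪯ ρ̄ for all k, with all ρ^k and ρ̄ diagonal positive definite), Condition B holds (Q̄ − Aᵀρ̄A is positive definite), and the Lagrangian L has a saddle point (x*, λ*). Then lim_{k→∞} (‖A x^{k+1}‖²_{ρ^k} + ‖x^{k+1} − x^k‖²_{Q̄ − Aᵀρ^k A}) = 0; in particular A x^k → 0 and x^{k+1} − x^k → 0 as k → ∞. -/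

import Mathlib

open Matrix Filter

/-- The weighted squared (semi-)norm `‖v‖²_M = vᵀ M v`. -/
noncomputable def msq {ι : Type*} [Fintype ι] (M : Matrix ι ι ℝ) (v : ι → ℝ) : ℝ :=
  v ⬝ᵥ (M *ᵥ v)

open scoped MatrixOrder in
/-- A sequence along which a positive definite quadratic form vanishes tends to zero. -/
theorem Matrix.PosDef.tendsto_zero_of_msq {ι α : Type*} [Fintype ι] [DecidableEq ι]
    {M : Matrix ι ι ℝ} (hM : M.PosDef) {F : Filter α} {v : α → ι → ℝ}
    (h : Tendsto (fun k => msq M (v k)) F (nhds 0)) : Tendsto v F (nhds 0) := by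
  obtain ⟨B, hB⟩ := CStarAlgebra.nonneg_iff_eq_star_mul_self.mp hM.posSemidef.nonneg
  rw [star_eq_conjTranspose, conjTranspose_eq_transpose_of_trivial] at hB
  have hsq : ∀ k, msq M (v k) = ∑ i, (B *ᵥ v k) i ^ 2 := fun k => by
    rw [msq, hB, ← mulVec_mulVec, dotProduct_transpose_mulVec]
    simp [dotProduct, sq]
  have hBv : Tendsto (fun k => B *ᵥ v k) F (nhds 0) := by
    refine tendsto_pi_nhds.2 fun i => ?_
    have hi : Tendsto (fun k => (B *ᵥ v k) i ^ 2) F (nhds 0) := by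
      refine squeeze_zero (fun k => sq_nonneg _) (fun k => ?_) h
      rw [hsq]
      exact Finset.single_le_sum (f := fun i => (B *ᵥ v k) i ^ 2)
        (fun j _ => sq_nonneg _) (Finset.mem_univ i)
    rw [Pi.zero_apply, tendsto_zero_iff_abs_tendsto_zero]
    simpa [Function.comp_def, Real.sqrt_sq_eq_abs] using hi.sqrt
  have hrec : ∀ k, v k = (M⁻¹ * Bᵀ) *ᵥ (B *ᵥ v k) := fun k => by
    rw [mulVec_mulVec, Matrix.mul_assoc, ← hB,
      nonsing_inv_mul _ ((isUnit_iff_isUnit_det _).1 hM.isUnit), one_mulVec]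
  have hcont : Continuous fun w : ι → ℝ => (M⁻¹ * Bᵀ) *ᵥ w :=
    continuous_const.matrix_mulVec continuous_id
  have := (hcont.tendsto 0).comp hBv
  rw [mulVec_zero] at this
  exact this.congr fun k => (hrec k).symm

/-- A differentiable convex function lies above its tangent planes. -/
theorem ConvexOn.add_fderiv_sub_le {V : Type*} [NormedAddCommGroup V] [NormedSpace ℝ V]
    {f : V → ℝ} (hf : ConvexOn ℝ Set.univ f) {x : V} (hx : DifferentiableAt ℝ f x) (y : V) :
    f x + fderiv ℝ f x (y - x) ≤ f y := by
  have hline : HasDerivAt (fun t : ℝ => AffineMap.lineMap x y t) (y - x) 0 :=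
    AffineMap.hasDerivAt_lineMap
  have hx' : HasFDerivAt f (fderiv ℝ f x) (AffineMap.lineMap x y (0 : ℝ)) := by
    simpa using hx.hasFDerivAt
  have h := (hf.comp_affineMap (AffineMap.lineMap (k := ℝ) x y)).le_slope_of_hasDerivAt
    (Set.mem_univ 0) (Set.mem_univ 1) one_pos (hx'.comp_hasDerivAt (0 : ℝ) hline)
  simp only [slope_def_field, Function.comp_apply, AffineMap.lineMap_apply_zero,
    AffineMap.lineMap_apply_one, sub_zero, div_one] at h
  linarith

/-- If the decrease of a nonnegative sequence dominates a nonnegative sequence, then the latter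
tends to zero. -/
theorem tendsto_zero_of_add_le {V a : ℕ → ℝ} (hV : ∀ k, 0 ≤ V k) (ha : ∀ k, 0 ≤ a k)
    (h : ∀ k, V (k + 1) + a k ≤ V k) : Tendsto a atTop (nhds 0) := by
  refine (summable_of_sum_range_le (c := V 0) ha fun n => ?_).tendsto_atTop_zero
  have : V n + ∑ i ∈ Finset.range n, a i ≤ V 0 := by
    induction n with
    | zero => simp
    | succ n ih => rw [Finset.sum_range_succ]; linarith [h n]
  linarith [hV n]

section msq

variable {ι κ : Type*} [Fintype ι] [Fintype κ]

theorem Matrix.PosSemidef.msq_nonneg {M : Matrix ι ι ℝ} (hM : M.PosSemidef) (v : ι → ℝ) :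
    0 ≤ msq M v := by
  simpa [msq] using hM.dotProduct_mulVec_nonneg v

theorem msq_sub_left (M M' : Matrix ι ι ℝ) (v : ι → ℝ) :
    msq (M - M') v = msq M v - msq M' v := by
  simp [msq, sub_mulVec, dotProduct_sub]

theorem msq_transpose_mul_mul (A : Matrix κ ι ℝ) (R : Matrix κ κ ℝ) (v : ι → ℝ) :
    msq (Aᵀ * R * A) v = msq R (A *ᵥ v) := by
  simp only [msq]
  rw [← mulVec_mulVec, ← mulVec_mulVec, dotProduct_transpose_mulVec, dotProduct_comm]

theorem msq_sub {M : Matrix ι ι ℝ} (hM : M.IsSymm) (v w : ι → ℝ) :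
    msq M (v - w) = msq M v - 2 * (v ⬝ᵥ (M *ᵥ w)) + msq M w := by
  have : w ⬝ᵥ (M *ᵥ v) = v ⬝ᵥ (M *ᵥ w) := by
    conv_lhs => rw [← hM.eq]
    exact dotProduct_transpose_mulVec M w v
  simp only [msq, mulVec_sub, dotProduct_sub, sub_dotProduct, this]
  ring

theorem msq_diagonal [DecidableEq ι] (p v : ι → ℝ) :
    msq (diagonal p) v = ∑ i, p i * v i ^ 2 := by
  simp only [msq, dotProduct, mulVec_diagonal]
  exact Finset.sum_congr rfl fun i _ => by ring

/-- One step of the linearized method of multipliers with diagonal penalty weights `p` followed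
by `q` decreases the Lyapunov function by the residual. Here `y`, `y'` are primal errors and
`m` is the dual error before the step. -/
theorem lyapunov_descent [DecidableEq κ] (A : Matrix κ ι ℝ) {Q : Matrix ι ι ℝ} (hQ : Q.IsSymm)
    {p q : κ → ℝ} (hp : ∀ i, 0 < p i) (hpq : ∀ i, p i ≤ q i) (y y' : ι → ℝ) (m : κ → ℝ)
    (h : m ⬝ᵥ (A *ᵥ y') + (A *ᵥ y') ⬝ᵥ (diagonal p *ᵥ (A *ᵥ y)) + y' ⬝ᵥ (Q *ᵥ (y' - y)) ≤ 0) :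
    (∑ i, (m + diagonal q *ᵥ (A *ᵥ y')) i ^ 2 / q i + msq (Q - Aᵀ * diagonal q * A) y')
      + (msq (diagonal p) (A *ᵥ y') + msq (Q - Aᵀ * diagonal p * A) (y' - y))
      ≤ ∑ i, m i ^ 2 / p i + msq (Q - Aᵀ * diagonal p * A) y := by
  have hy : msq Q y = msq Q y' - 2 * (y' ⬝ᵥ (Q *ᵥ (y' - y))) + msq Q (y' - y) := by
    rw [← msq_sub hQ, sub_sub_cancel]
  simp only [msq_sub_left, msq_transpose_mul_mul, msq_diagonal, hy, mulVec_sub A]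
  have key : ∑ i, (m + diagonal q *ᵥ (A *ᵥ y')) i ^ 2 / q i - ∑ i, q i * (A *ᵥ y') i ^ 2
      + ∑ i, p i * (A *ᵥ y') i ^ 2 - ∑ i, p i * (A *ᵥ y' - A *ᵥ y) i ^ 2
      ≤ ∑ i, m i ^ 2 / p i - ∑ i, p i * (A *ᵥ y) i ^ 2
        + 2 * (m ⬝ᵥ (A *ᵥ y') + (A *ᵥ y') ⬝ᵥ (diagonal p *ᵥ (A *ᵥ y))) := by
    simp only [dotProduct, ← Finset.sum_add_distrib, ← Finset.sum_sub_distrib, Finset.mul_sum]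
    refine Finset.sum_le_sum fun i _ => ?_
    have hq : 0 < q i := (hp i).trans_le (hpq i)
    have hm : m i ^ 2 / q i ≤ m i ^ 2 / p i :=
      div_le_div_of_nonneg_left (sq_nonneg _) (hp i) (hpq i)
    have hexp : (m i + q i * (A *ᵥ y') i) ^ 2 / q i
        = m i ^ 2 / q i + 2 * m i * (A *ᵥ y') i + q i * (A *ᵥ y') i ^ 2 := by
      field_simp
      ring
    simp only [Pi.add_apply, Pi.sub_apply, mulVec_diagonal, hexp]
    linarith
  linarith

end msq

/-- Theorem 4 of the paper: under Conditions A and B, the residuals of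
the ADMM with time-varying penalty matrices vanish asymptotically. -/
theorem admm_residuals_vanish
    (N D E : ℕ) (hN : 0 < N) (hD : 0 < D) (hE : 0 < E)
    (f : (Fin (N * D) → ℝ) → ℝ) (gf : (Fin (N * D) → ℝ) → (Fin (N * D) → ℝ))
    (hconv : ConvexOn ℝ Set.univ f) (hsmooth : ContDiff ℝ 1 f)
    (hgrad : ∀ x v, fderiv ℝ f x v = gf x ⬝ᵥ v)
    (A : Matrix (Fin (E * D)) (Fin (N * D)) ℝ)
    (x : ℕ → (Fin (N * D) → ℝ)) (l : ℕ → (Fin (E * D) → ℝ))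
    (ρ : ℕ → Matrix (Fin (E * D)) (Fin (E * D)) ℝ)
    (ρbar : Matrix (Fin (E * D)) (Fin (E * D)) ℝ)
    (Q : Matrix (Fin (N * D)) (Fin (N * D)) ℝ) (hQ : Q.IsSymm)
    -- iterates
    (hopt : ∀ k, gf (x (k + 1)) + Aᵀ *ᵥ (l k) + Aᵀ *ᵥ (ρ k *ᵥ (A *ᵥ x k))
      + Q *ᵥ (x (k + 1) - x k) = 0)
    (hlam : ∀ k, l (k + 1) = l k + ρ (k + 1) *ᵥ (A *ᵥ x (k + 1)))
    -- Condition A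
    (hρdiag : ∀ k, (ρ k).IsDiag) (hρpos : ∀ k, (ρ k).PosDef)
    (hρbardiag : ρbar.IsDiag) (hρbarpos : ρbar.PosDef)
    (hρmono : ∀ k, (ρ (k + 1) - ρ k).PosSemidef)
    (hρ0 : ∀ k, (ρ k - ρ 0).PosSemidef)
    (hρbar : ∀ k, (ρbar - ρ k).PosSemidef)
    -- Condition B
    (hB : (Q - Aᵀ * ρbar * A).PosDef)
    -- saddle point
    (xs : Fin (N * D) → ℝ) (ls : Fin (E * D) → ℝ)
    (hsaddle : ∀ (y : Fin (N * D) → ℝ) (μ : Fin (E * D) → ℝ),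
      f xs + μ ⬝ᵥ (A *ᵥ xs) ≤ f xs + ls ⬝ᵥ (A *ᵥ xs) ∧
      f xs + ls ⬝ᵥ (A *ᵥ xs) ≤ f y + ls ⬝ᵥ (A *ᵥ y)) :
    Tendsto (fun k => msq (ρ k) (A *ᵥ x (k + 1))
        + msq (Q - Aᵀ * ρ k * A) (x (k + 1) - x k)) atTop (nhds 0)
    ∧ Tendsto (fun k => A *ᵥ x k) atTop (nhds 0)
    ∧ Tendsto (fun k => x (k + 1) - x k) atTop (nhds 0) := by
  have hAxs : A *ᵥ xs = 0 := by
    have h := (hsaddle xs (ls + A *ᵥ xs)).1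
    rw [add_dotProduct] at h
    have h0 : 0 ≤ (A *ᵥ xs) ⬝ᵥ (A *ᵥ xs) := by
      simpa using dotProduct_star_self_nonneg (A *ᵥ xs)
    exact dotProduct_self_eq_zero.1 (by linarith)
  have hA : ∀ z, A *ᵥ (z - xs) = A *ᵥ z := fun z => by rw [mulVec_sub, hAxs, sub_zero]
  obtain ⟨d, hd⟩ : ∃ d : ℕ → Fin (E * D) → ℝ, ∀ k, ρ k = diagonal (d k) :=
    ⟨fun k => (ρ k).diag, fun k => (hρdiag k).diagonal_diag.symm⟩
  have hdpos : ∀ k i, 0 < d k i := fun k i => by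
    simpa [hd] using (hρpos k).diag_pos (i := i)
  have hdmono : ∀ k i, d k i ≤ d (k + 1) i := fun k i => by
    simpa [hd] using (hρmono k).diag_nonneg (i := i)
  have hgradient : ∀ k, 0 ≤ gf (x (k + 1)) ⬝ᵥ (x (k + 1) - xs) + ls ⬝ᵥ (A *ᵥ x (k + 1)) :=
    fun k => by
    have h₁ := hconv.add_fderiv_sub_le (hsmooth.differentiable one_ne_zero (x (k + 1))) xs
    have h₂ := (hsaddle (x (k + 1)) ls).2
    rw [hgrad, ← neg_sub (x (k + 1)) xs, dotProduct_neg] at h₁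
    rw [hAxs, dotProduct_zero] at h₂
    linarith
  have hstep : ∀ k, (l k - ls) ⬝ᵥ (A *ᵥ (x (k + 1) - xs))
      + (A *ᵥ (x (k + 1) - xs)) ⬝ᵥ (diagonal (d k) *ᵥ (A *ᵥ (x k - xs)))
      + (x (k + 1) - xs) ⬝ᵥ (Q *ᵥ ((x (k + 1) - xs) - (x k - xs))) ≤ 0 := fun k => by
    have h := congrArg (fun w => (x (k + 1) - xs) ⬝ᵥ w) (hopt k)
    simp only [dotProduct_add, dotProduct_transpose_mulVec, dotProduct_zero, hA] at h
    rw [hA, hA, ← hd, sub_sub_sub_cancel_right, sub_dotProduct,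
      dotProduct_comm (A *ᵥ x (k + 1))]
    have := hgradient k
    rw [dotProduct_comm (gf _)] at this
    linarith
  have hP : ∀ k v, msq (Q - Aᵀ * ρbar * A) v ≤ msq (Q - Aᵀ * ρ k * A) v := fun k v => by
    have := (hρbar k).msq_nonneg (A *ᵥ v)
    rw [msq_sub_left] at this
    simp only [msq_sub_left, msq_transpose_mul_mul]
    linarith
  have hP₀ : ∀ k v, 0 ≤ msq (Q - Aᵀ * ρ k * A) v := fun k v =>
    (hB.posSemidef.msq_nonneg v).trans (hP k v)
  have hlim : Tendsto (fun k => msq (ρ k) (A *ᵥ x (k + 1))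
      + msq (Q - Aᵀ * ρ k * A) (x (k + 1) - x k)) atTop (nhds 0) := by
    refine tendsto_zero_of_add_le
      (V := fun k => ∑ i, (l k - ls) i ^ 2 / d k i + msq (Q - Aᵀ * ρ k * A) (x k - xs))
      (fun k => add_nonneg
        (Finset.sum_nonneg fun i _ => div_nonneg (sq_nonneg _) (hdpos k i).le) (hP₀ k _))
      (fun k => add_nonneg ((hρpos k).posSemidef.msq_nonneg _) (hP₀ k _)) fun k => ?_
    have h := lyapunov_descent A hQ (hdpos k) (hdmono k) _ _ _ (hstep k)
    rw [hA, sub_sub_sub_cancel_right, ← hd, ← hd, sub_add_eq_add_sub, ← hlam] at h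
    exact h
  refine ⟨hlim, ?_, ?_⟩
  · rw [← tendsto_add_atTop_iff_nat 1]
    refine (hρpos 0).tendsto_zero_of_msq
      (squeeze_zero (fun k => (hρpos 0).posSemidef.msq_nonneg _) (fun k => ?_) hlim)
    have := (hρ0 k).msq_nonneg (A *ᵥ x (k + 1))
    rw [msq_sub_left] at this
    linarith [hP₀ k (x (k + 1) - x k)]
  · refine hB.tendsto_zero_of_msq
      (squeeze_zero (fun k => hB.posSemidef.msq_nonneg _) (fun k => ?_) hlim)
    linarith [hP k (x (k + 1) - x k), (hρpos k).posSemidef.msq_nonneg (A *ᵥ x (k + 1))]
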